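/- Let L be a nonempty locally compact Hausdorff topological space and Y a real Banach space. The space C₀(L, Y) of continuous Y-valued functions on L vanishing at infinity, with the supremum norm, has the approximate hyperplane sum property for ℓ∞⁴ if and only if Y has the approximate hyperplane sum property for ℓ∞⁴. -/

import Mathlib

/-- `M_Y^4`: quadruples `(y₁,y₂,y₃,y₄)` in the closed unit ball of `Y` such that
`‖y_{i₁} − y_{i₂} + y_{i₃}‖ ≤ 1` for all `i₁ < i₂ < i₃`. -/
def MY4 {Y : Type*} [NormedAddCommGroup Y] (y : Fin 4 → Y) : Prop :=
  (∀ i, ‖y i‖ ≤ 1) ∧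
    ∀ i j k : Fin 4, i < j → j < k → ‖y i - y j + y k‖ ≤ 1

/-- `Y` has the approximate hyperplane sum property for `ℓ∞⁴` with the function `γ`. -/
def AHSpL4With (Y : Type*) [NormedAddCommGroup Y] [NormedSpace ℝ Y] (γ : ℝ → ℝ) : Prop :=
  ∀ ε : ℝ, 0 < ε → ε < 1 →
    (0 < γ ε ∧ γ ε < ε) ∧
    ∀ y : Fin 4 → Y, MY4 y →
      ∀ A : Finset (Fin 4), A.Nonempty →
        ∀ f : Y →L[ℝ] ℝ, ‖f‖ = 1 →
          (∀ i ∈ A, 1 - γ ε < f (y i)) →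
          ∃ z : Fin 4 → Y, MY4 z ∧ (∀ i, ‖z i - y i‖ < ε) ∧
            ‖∑ i ∈ A, z i‖ = (A.card : ℝ)

open ZeroAtInfty

namespace ZeroAtInftyContinuousMap

variable {L Y : Type*} [TopologicalSpace L] [NormedAddCommGroup Y]

theorem norm_apply_le_norm (f : C₀(L, Y)) (t : L) : ‖f t‖ ≤ ‖f‖ :=
  f.toBCF.norm_coe_le_norm t

theorem norm_le_iff {f : C₀(L, Y)} {C : ℝ} (hC : 0 ≤ C) : ‖f‖ ≤ C ↔ ∀ t, ‖f t‖ ≤ C :=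
  BoundedContinuousFunction.norm_le (f := f.toBCF) hC

theorem exists_norm_apply_eq_norm [Nonempty L] (f : C₀(L, Y)) : ∃ t, ‖f t‖ = ‖f‖ := by
  suffices h : ∃ t, ∀ s, ‖f s‖ ≤ ‖f t‖ by
    obtain ⟨t, ht⟩ := h
    exact ⟨t, (norm_apply_le_norm f t).antisymm ((norm_le_iff (norm_nonneg _)).2 ht)⟩
  by_cases h0 : ∃ t, f t ≠ 0
  · obtain ⟨t, ht⟩ := h0
    have hf : Continuous fun s => ‖f s‖ := (map_continuous f).norm
    have hlim : Filter.Tendsto (fun s => ‖f s‖) (Filter.cocompact L) (nhds 0) := by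
      simpa using (zero_at_infty f).norm
    exact hf.exists_forall_ge' t (hlim.eventually_le_const (norm_pos_iff.2 ht))
  · push Not at h0
    exact ⟨Classical.arbitrary L, fun s => by simp [h0]⟩

protected theorem sum_apply {ι : Type*} (s : Finset ι) (f : ι → C₀(L, Y)) (t : L) :
    (∑ i ∈ s, f i) t = ∑ i ∈ s, f i t :=
  map_sum ({ toFun := fun g => g t, map_zero' := rfl, map_add' := fun _ _ => rfl } :
    C₀(L, Y) →+ Y) f s

variable [NormedSpace ℝ Y]

/-- Evaluation at a point, as a continuous linear map on `C₀(L, Y)`. -/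
noncomputable def evalCLM (t : L) : C₀(L, Y) →L[ℝ] Y :=
  LinearMap.mkContinuous
    { toFun := fun f => f t, map_add' := fun _ _ => rfl, map_smul' := fun _ _ => rfl } 1
    fun f => by simpa using norm_apply_le_norm f t

@[simp]
theorem evalCLM_apply (t : L) (f : C₀(L, Y)) : evalCLM t f = f t := rfl

/-- The product of a compactly supported scalar function and a continuous function. -/
def cutoff (u : C(L, ℝ)) (hu : HasCompactSupport u) (g : C(L, Y)) : C₀(L, Y) where
  toFun t := u t • g t
  continuous_toFun := by fun_prop
  zero_at_infty' := (HasCompactSupport.smul_right (f' := g) hu).is_zero_at_infty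

@[simp]
theorem cutoff_apply (u : C(L, ℝ)) (hu : HasCompactSupport u) (g : C(L, Y)) (t : L) :
    cutoff u hu g t = u t • g t := rfl

end ZeroAtInftyContinuousMap

open ZeroAtInftyContinuousMap

theorem exists_bump_of_mem_nhds {L : Type*} [TopologicalSpace L] [LocallyCompactSpace L]
    [T2Space L] {t₀ : L} {U : Set L} (hU : U ∈ nhds t₀) :
    ∃ u : C(L, ℝ), HasCompactSupport u ∧ u t₀ = 1 ∧ (∀ t, 0 ≤ u t ∧ u t ≤ 1) ∧
      ∀ t ∉ U, u t = 0 := by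
  obtain ⟨V, hVU, hV, ht₀⟩ := mem_nhds_iff.1 hU
  obtain ⟨u, h1, h0, hc, hI⟩ := exists_continuous_one_zero_of_isCompact
    (isCompact_singleton (x := t₀)) hV.isClosed_compl (by simpa using ht₀)
  exact ⟨u, hc, h1 rfl, hI, fun t ht => h0 fun h => ht (hVU h)⟩

section MY4

variable {L Y : Type*} [TopologicalSpace L] [NormedAddCommGroup Y]

theorem MY4_iff_forall_apply {f : Fin 4 → C₀(L, Y)} : MY4 f ↔ ∀ t, MY4 fun i => f i t := by
  constructor
  · exact fun h t => ⟨fun i => (norm_apply_le_norm _ t).trans (h.1 i), fun i j k hij hjk =>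
      (norm_apply_le_norm (f i - f j + f k) t).trans (h.2 i j k hij hjk)⟩
  · exact fun h => ⟨fun i => (norm_le_iff zero_le_one).2 fun t => (h t).1 i,
      fun i j k hij hjk => (norm_le_iff zero_le_one).2 fun t => (h t).2 i j k hij hjk⟩

variable [NormedSpace ℝ Y]

theorem MY4.convex_combination {y z : Fin 4 → Y} (hy : MY4 y) (hz : MY4 z) {a : ℝ}
    (ha0 : 0 ≤ a) (ha1 : a ≤ 1) : MY4 fun i => y i + a • (z i - y i) := by
  have key : ∀ v w : Y, ‖v‖ ≤ 1 → ‖w‖ ≤ 1 → ‖v + a • (w - v)‖ ≤ 1 := fun v w hv hw => by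
    have := (convex_closedBall (0 : Y) 1).add_smul_sub_mem (x := v) (y := w)
      (by simpa using hv) (by simpa using hw) ⟨ha0, ha1⟩
    simpa using this
  refine ⟨fun i => key _ _ (hy.1 i) (hz.1 i), fun i j k hij hjk => ?_⟩
  convert key _ _ (hy.2 i j k hij hjk) (hz.2 i j k hij hjk) using 2
  module

theorem MY4.smul {y : Fin 4 → Y} (hy : MY4 y) {a : ℝ} (ha0 : 0 ≤ a) (ha1 : a ≤ 1) :
    MY4 fun i => a • y i := by
  have h0 : MY4 (0 : Fin 4 → Y) := ⟨by simp, by simp⟩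
  simpa using h0.convex_combination hy ha0 ha1

end MY4

theorem norm_comp_evalCLM {L Y : Type*} [TopologicalSpace L] [LocallyCompactSpace L] [T2Space L]
    [NormedAddCommGroup Y] [NormedSpace ℝ Y] (f : Y →L[ℝ] ℝ) (t₀ : L) :
    ‖f.comp (evalCLM t₀ : C₀(L, Y) →L[ℝ] Y)‖ = ‖f‖ := by
  apply le_antisymm
  · refine ContinuousLinearMap.opNorm_le_bound _ (norm_nonneg _) fun g => ?_
    exact (f.le_opNorm _).trans (by gcongr; exact norm_apply_le_norm g t₀)
  · obtain ⟨u, hc, hu1, hI, -⟩ := exists_bump_of_mem_nhds (Filter.univ_mem (f := nhds t₀))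
    refine f.opNorm_le_bound (ContinuousLinearMap.opNorm_nonneg _) fun y => ?_
    have h := (f.comp (evalCLM t₀ : C₀(L, Y) →L[ℝ] Y)).le_opNorm
      (cutoff u hc (ContinuousMap.const L y))
    have hy : ‖cutoff u hc (ContinuousMap.const L y)‖ ≤ ‖y‖ :=
      (norm_le_iff (norm_nonneg _)).2 fun t => by
        simpa [norm_smul, abs_of_nonneg (hI t).1] using
          mul_le_of_le_one_left (norm_nonneg y) (hI t).2
    simp only [ContinuousLinearMap.comp_apply, evalCLM_apply, cutoff_apply, hu1, one_smul,
      ContinuousMap.const_apply] at h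
    exact h.trans (by gcongr)

theorem norm_eq_one_of_norm_sum_eq_card {ι Y : Type*} [NormedAddCommGroup Y] {s : Finset ι}
    {z : ι → Y} (hz : ∀ i, ‖z i‖ ≤ 1) (hs : ‖∑ i ∈ s, z i‖ = s.card) {i : ι} (hi : i ∈ s) :
    ‖z i‖ = 1 := by
  have h : ∑ i ∈ s, ‖z i‖ = ∑ _i ∈ s, (1 : ℝ) := by
    refine (Finset.sum_le_sum fun i _ => hz i).antisymm ?_
    simpa [← hs] using norm_sum_le s z
  exact (Finset.sum_eq_sum_iff_of_le fun i _ => hz i).1 h i hi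

theorem lt_of_card_sub_lt_sum {ι : Type*} {s : Finset ι} {a : ι → ℝ} (ha : ∀ i, a i ≤ 1)
    {δ : ℝ} (hs : (s.card : ℝ) - δ < ∑ i ∈ s, a i) {i : ι} (hi : i ∈ s) : 1 - δ < a i := by
  have h1 : 1 - a i ≤ ∑ j ∈ s, (1 - a j) :=
    Finset.single_le_sum (f := fun j => 1 - a j) (fun j _ => sub_nonneg.2 (ha j)) hi
  simp only [Finset.sum_sub_distrib, Finset.sum_const, nsmul_eq_mul, mul_one] at h1
  linarith

theorem AHSpL4With.of_zeroAtInfty {L Y : Type*} [TopologicalSpace L] [LocallyCompactSpace L]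
    [T2Space L] [Nonempty L] [NormedAddCommGroup Y] [NormedSpace ℝ Y] {γ : ℝ → ℝ}
    (h : AHSpL4With C₀(L, Y) γ) : AHSpL4With Y fun ε => γ (ε / 2) := by
  intro ε hε0 hε1
  obtain ⟨⟨hγ0, hγ1⟩, H⟩ := h (ε / 2) (by linarith) (by linarith)
  refine ⟨⟨hγ0, by linarith⟩, fun y hy A hA f hf hfy => ?_⟩
  let t₀ : L := Classical.arbitrary L
  obtain ⟨u, hc, hu1, hI, -⟩ := exists_bump_of_mem_nhds (Filter.univ_mem (f := nhds t₀))
  obtain ⟨g, hg, hgd, hgs⟩ := H (fun i => cutoff u hc (ContinuousMap.const L (y i)))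
    (MY4_iff_forall_apply.2 fun t => hy.smul (hI t).1 (hI t).2) A hA (f.comp (evalCLM t₀))
    (by rw [norm_comp_evalCLM, hf]) fun i hi => by simpa [hu1] using hfy i hi
  obtain ⟨t, ht⟩ := exists_norm_apply_eq_norm (∑ i ∈ A, g i)
  rw [hgs, ZeroAtInftyContinuousMap.sum_apply] at ht
  have hgt := MY4_iff_forall_apply.1 hg t
  have hdist : ∀ i, ‖g i t - u t • y i‖ < ε / 2 := fun i =>
    (norm_apply_le_norm (g i - cutoff u hc (ContinuousMap.const L (y i))) t).trans_lt (hgd i)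
  have hut : 1 - u t < ε / 2 := by
    obtain ⟨i, hi⟩ := hA
    have h1 := norm_eq_one_of_norm_sum_eq_card hgt.1 ht hi
    have h2 : ‖u t • y i‖ ≤ u t := by
      rw [norm_smul, Real.norm_of_nonneg (hI t).1]
      exact mul_le_of_le_one_right (hI t).1 (hy.1 i)
    have h3 := norm_sub_norm_le (g i t) (u t • y i)
    linarith [hdist i]
  refine ⟨fun i => g i t, hgt, fun i => ?_, ht⟩
  have h2 : ‖u t • y i - y i‖ ≤ 1 - u t := by
    rw [show u t • y i - y i = -((1 - u t) • y i) by module, norm_neg, norm_smul,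
      Real.norm_of_nonneg (sub_nonneg.2 (hI t).2)]
    exact mul_le_of_le_one_right (sub_nonneg.2 (hI t).2) (hy.1 i)
  have h3 := norm_sub_le_norm_sub_add_norm_sub (g i t) (u t • y i) (y i)
  linarith [hdist i]

theorem AHSpL4With.zeroAtInfty {L Y : Type*} [TopologicalSpace L] [LocallyCompactSpace L]
    [T2Space L] [Nonempty L] [NormedAddCommGroup Y] [NormedSpace ℝ Y] {γ : ℝ → ℝ}
    (h : AHSpL4With Y γ) : AHSpL4With C₀(L, Y) fun ε => γ (ε / 2) / 4 := by
  intro ε hε0 hε1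
  obtain ⟨⟨hγ0, hγ1⟩, H⟩ := h (ε / 2) (by linarith) (by linarith)
  refine ⟨⟨by positivity, by linarith⟩, fun y hy A hA f hf hfy => ?_⟩
  have hcard : (A.card : ℝ) ≤ 4 := by exact_mod_cast A.card_le_univ
  have hcard1 : (1 : ℝ) ≤ A.card := by exact_mod_cast hA.card_pos
  have hsum : (A.card : ℝ) - γ (ε / 2) < ‖∑ i ∈ A, y i‖ := by
    have h1 : ∑ _i ∈ A, (1 - γ (ε / 2) / 4) < ∑ i ∈ A, f (y i) :=
      Finset.sum_lt_sum_of_nonempty hA hfy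
    rw [Finset.sum_const, nsmul_eq_mul, ← map_sum] at h1
    have h2 := (le_abs_self _).trans (f.le_opNorm (∑ i ∈ A, y i))
    rw [hf, one_mul] at h2
    nlinarith
  obtain ⟨t₀, ht₀⟩ := exists_norm_apply_eq_norm (∑ i ∈ A, y i)
  rw [← ht₀, ZeroAtInftyContinuousMap.sum_apply] at hsum
  obtain ⟨p, hp, hpy⟩ := exists_dual_vector ℝ (∑ i ∈ A, y i t₀) (by linarith)
  have hyt := MY4_iff_forall_apply.1 hy
  obtain ⟨z, hz, hzd, hzs⟩ := H (fun i => y i t₀) (hyt t₀) A hA p hp fun i hi => by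
    refine lt_of_card_sub_lt_sum (a := fun i => p (y i t₀)) (fun i => ?_) ?_ hi
    · refine (le_abs_self _).trans ((p.le_opNorm _).trans ?_)
      rw [hp, one_mul]
      exact (hyt t₀).1 i
    · rw [← map_sum, hpy]
      exact hsum
  have hU : {t | ∀ i, ‖y i t - y i t₀‖ < ε / 4} ∈ nhds t₀ := by
    refine Filter.eventually_all.2 fun i => ?_
    have hc : Continuous fun t => ‖y i t - y i t₀‖ :=
      ((map_continuous (y i)).sub continuous_const).norm
    exact hc.continuousAt.eventually_lt_const (by simpa using hε0)
  obtain ⟨u, hc, hu1, hI, hu0⟩ := exists_bump_of_mem_nhds hU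
  let g : Fin 4 → C₀(L, Y) := fun i =>
    y i + cutoff u hc (ContinuousMap.const L (z i) - (y i).toContinuousMap)
  have hg : MY4 g :=
    MY4_iff_forall_apply.2 fun t => (hyt t).convex_combination hz (hI t).1 (hI t).2
  refine ⟨g, hg, fun i => ?_, le_antisymm ?_ ?_⟩
  · refine lt_of_le_of_lt ((norm_le_iff (C := 3 * ε / 4) (by positivity)).2 fun t => ?_)
      (by linarith)
    have hgt : (g i - y i) t = u t • (z i - y i t) := add_sub_cancel_left _ _
    rw [hgt, norm_smul, Real.norm_of_nonneg (hI t).1]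
    by_cases ht : ∀ i, ‖y i t - y i t₀‖ < ε / 4
    · refine (mul_le_of_le_one_left (norm_nonneg _) (hI t).2).trans ?_
      have h3 := norm_sub_le_norm_sub_add_norm_sub (z i) (y i t₀) (y i t)
      rw [norm_sub_rev (y i t₀)] at h3
      linarith [ht i, hzd i]
    · rw [hu0 t ht, zero_mul]
      positivity
  · simpa using norm_sum_le_of_le A fun i _ => hg.1 i
  · have hgt₀ : ∀ i, g i t₀ = z i := fun i => by
      change y i t₀ + u t₀ • (z i - y i t₀) = z i
      rw [hu1, one_smul, add_sub_cancel]
    have h1 := norm_apply_le_norm (∑ i ∈ A, g i) t₀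
    rwa [ZeroAtInftyContinuousMap.sum_apply, Finset.sum_congr rfl fun i _ => hgt₀ i, hzs] at h1

/-- For a nonempty locally compact Hausdorff space `L` and a real Banach space `Y`,
`C₀(L, Y)` has the AHSp-`ℓ∞⁴` if and only if `Y` has the AHSp-`ℓ∞⁴`. -/
theorem stmt14 (L : Type*) [TopologicalSpace L] [LocallyCompactSpace L] [T2Space L]
    [Nonempty L] (Y : Type*) [NormedAddCommGroup Y] [NormedSpace ℝ Y] [CompleteSpace Y] :
    (∃ γ : ℝ → ℝ, AHSpL4With C₀(L, Y) γ) ↔ (∃ γ : ℝ → ℝ, AHSpL4With Y γ) :=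
  ⟨fun ⟨_, h⟩ => ⟨_, h.of_zeroAtInfty⟩, fun ⟨_, h⟩ => ⟨_, h.zeroAtInfty⟩⟩
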